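/- If X is a topological space of countable spread (every discrete subspace of X is countable) with Δ(X) > ω, then X is maximally resolvable. -/

import Mathlib

open Cardinal

/-- A space is `κ`-resolvable if it contains `κ` pairwise disjoint dense subsets. -/
def Resolvable (X : Type*) [TopologicalSpace X] (κ : Cardinal) : Prop :=
  ∃ D : Set (Set X), #D = κ ∧ (∀ d ∈ D, Dense d) ∧ D.PairwiseDisjoint id

/-- `Δ(X)`: the minimum cardinality of a nonempty open subset of `X`. -/
noncomputable def Delta (X : Type*) [TopologicalSpace X] : Cardinal :=
  sInf {c : Cardinal | ∃ U : Set X, IsOpen U ∧ U.Nonempty ∧ #U = c}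

/-- `X` is maximally resolvable if it is `Δ(X)`-resolvable. -/
def MaximallyResolvable (X : Type*) [TopologicalSpace X] : Prop :=
  Resolvable X (Delta X)

universe u

/-- Transfinite recursion of length `c`: choose a sequence in `P` with each term related by `G` to
the set of earlier terms. -/
theorem exists_seq {β : Type u} {c : Cardinal.{u}} (P : β → Prop)
    (G : c.ord.ToType → Set β → β → Prop)
    (h : ∀ a (A : Set β), #A < c → (∀ y ∈ A, P y) → ∃ x, P x ∧ G a A x) :
    ∃ z : c.ord.ToType → β, ∀ a, P (z a) ∧ G a (z '' Set.Iio a) (z a) := by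
  classical
  rcases isEmpty_or_nonempty c.ord.ToType with hK | ⟨⟨a₀⟩⟩
  · exact ⟨fun a => hK.elim a, fun a => hK.elim a⟩
  have hc : 0 < c := by
    rw [← mk_ord_toType c]
    exact pos_iff_ne_zero.2 (mk_ne_zero_iff.2 ⟨a₀⟩)
  obtain ⟨b₀, -⟩ := h a₀ ∅ (by simpa using hc) (by simp)
  let F : (a : c.ord.ToType) → ((b : c.ord.ToType) → b < a → β) → β := fun a ih =>
    if H : ∃ x, P x ∧ G a {y | ∃ b, ∃ hb : b < a, ih b hb = y} x then H.choose else b₀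
  have wf : WellFounded ((· < ·) : c.ord.ToType → c.ord.ToType → Prop) := wellFounded_lt
  let z := wf.fix F
  have hz : ∀ a, z a = F a (fun b _ => z b) := fun a => wf.fix_eq F a
  have hset : ∀ a, {y | ∃ b, ∃ _ : b < a, z b = y} = z '' Set.Iio a := by
    intro a; ext y; simp
  refine ⟨z, fun a => ?_⟩
  induction a using WellFoundedLT.induction with
  | ind a ih =>
    have H : ∃ x, P x ∧ G a {y | ∃ b, ∃ _ : b < a, z b = y} x := by
      rw [hset]
      refine h a _ (mk_image_le.trans_lt ((mk_Iio_lt a (by simp)).trans_eq (mk_ord_toType c))) ?_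
      rintro _ ⟨b, hb, rfl⟩
      exact (ih b hb).1
    have := H.choose_spec
    rw [hz a]
    simp only [F]
    rw [dif_pos H]
    rw [← hset]
    exact this

/-- Functions given on pairwise disjoint sets have a common extension. -/
theorem exists_glue {ι X β : Type*} [Nonempty β] (D : ι → Set X)
    (hD : ∀ i j, ∀ x ∈ D i, x ∈ D j → i = j) (f : ι → X → β) :
    ∃ g : X → β, ∀ i, ∀ x ∈ D i, g x = f i x := by
  classical
  refine ⟨fun x => if h : ∃ i, x ∈ D i then f h.choose x else Classical.arbitrary β, ?_⟩
  intro i x hx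
  have h : ∃ i, x ∈ D i := ⟨i, hx⟩
  simp only [dif_pos h]
  rw [hD _ _ x h.choose_spec hx]

section Basic

variable {X : Type u} [TopologicalSpace X]

/-- The subspace `Z` can be coloured so that each of the first `c` colours is dense in it. -/
def ResolvableOn (c : Cardinal.{u}) (Z : Set X) : Prop :=
  ∃ f : X → Ordinal.{u}, ∀ i < c.ord, Z ⊆ closure {x ∈ Z | f x = i}

/-- Every nonempty relatively open subset of `Z` has at least `κ` points. -/
def LocallyLarge (κ : Cardinal.{u}) (Z : Set X) : Prop :=
  ∀ U : Set X, IsOpen U → (U ∩ Z).Nonempty → κ ≤ #↑(U ∩ Z)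

theorem resolvableOn_empty (c : Cardinal.{u}) : ResolvableOn c (∅ : Set X) :=
  ⟨fun _ => 0, fun _ _ => Set.empty_subset _⟩

theorem resolvableOn_of_family {c : Cardinal.{u}} {Z : Set X} {ι : Type u} (hι : c ≤ #ι)
    (E : ι → Set X) (hE : ∀ i, E i ⊆ Z) (hd : ∀ i, Z ⊆ closure (E i))
    (hdisj : ∀ i j, ∀ x ∈ E i, x ∈ E j → i = j) : ResolvableOn c Z := by
  rw [← mk_ord_toType c] at hι
  obtain ⟨e⟩ := hι
  obtain ⟨g, hg⟩ := exists_glue (fun t => E (e t))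
    (fun i j x hi hj => e.injective (hdisj _ _ x hi hj))
    (fun t _ => (Ordinal.ToType.mk.symm t : Ordinal.{u}))
  refine ⟨g, fun i hi => ?_⟩
  have := hd (e (Ordinal.ToType.mk ⟨i, hi⟩))
  refine this.trans (closure_mono fun x hx => ⟨hE _ hx, ?_⟩)
  rw [hg _ x hx]
  simp

/-- A union of pairwise disjoint resolvable pieces, each coloured separately. -/
theorem resolvableOn_iUnion {c : Cardinal.{u}} {ι : Type*} (D : ι → Set X)
    (hD : ∀ i j, ∀ x ∈ D i, x ∈ D j → i = j) (h : ∀ i, ResolvableOn c (D i)) :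
    ResolvableOn c (⋃ i, D i) := by
  choose f hf using h
  obtain ⟨g, hg⟩ := exists_glue D hD f
  refine ⟨g, fun k hk => Set.iUnion_subset fun i => (hf i k hk).trans (closure_mono ?_)⟩
  rintro x ⟨hx, hxk⟩
  exact ⟨Set.mem_iUnion.2 ⟨i, hx⟩, (hg i x hx).trans hxk⟩

/-- Disjoint dense subspaces, cofinally resolvable. -/
theorem resolvableOn_of_cofinal {c : Cardinal.{u}} {Z : Set X} {ι : Type*} (D : ι → Set X)
    (hD : ∀ i j, ∀ x ∈ D i, x ∈ D j → i = j) (hDZ : ∀ i, D i ⊆ Z) (l : ι → Cardinal.{u})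
    (h : ∀ i, ResolvableOn (l i) (D i))
    (hc : ∀ k < c.ord, ∃ i, k < (l i).ord ∧ Z ⊆ closure (D i)) :
    ResolvableOn c Z := by
  choose f hf using h
  obtain ⟨g, hg⟩ := exists_glue D hD f
  refine ⟨g, fun k hk => ?_⟩
  obtain ⟨i, hi, hZ⟩ := hc k hk
  refine hZ.trans (closure_minimal ((hf i k hi).trans (closure_mono ?_)) isClosed_closure)
  rintro x ⟨hx, hxk⟩
  exact ⟨hDZ i hx, (hg i x hx).trans hxk⟩

theorem ResolvableOn.of_dense {c : Cardinal.{u}} {Z D : Set X} (h : ResolvableOn c D)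
    (hD : D ⊆ Z) (hd : Z ⊆ closure D) : ResolvableOn c Z := by
  obtain ⟨f, hf⟩ := h
  exact ⟨f, fun i hi => hd.trans (closure_minimal ((hf i hi).trans
    (closure_mono fun x hx => ⟨hD hx.1, hx.2⟩)) isClosed_closure)⟩

/-- A maximal disjoint family of nonempty subsets of `Z` satisfying `P`. -/
theorem exists_maximal_disjoint {X : Type*} (P : Set X → Prop) (Z : Set X) :
    ∃ 𝓢 : Set (Set X), (∀ S ∈ 𝓢, S ⊆ Z ∧ S.Nonempty ∧ P S) ∧
      (∀ S ∈ 𝓢, ∀ T ∈ 𝓢, ∀ x ∈ S, x ∈ T → S = T) ∧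
      ∀ S ⊆ Z, S.Nonempty → P S → (S ∩ ⋃₀ 𝓢).Nonempty := by
  obtain ⟨𝓢, h𝓢⟩ := zorn_subset {𝓢 : Set (Set X) | (∀ S ∈ 𝓢, S ⊆ Z ∧ S.Nonempty ∧ P S) ∧
      (∀ S ∈ 𝓢, ∀ T ∈ 𝓢, ∀ x ∈ S, x ∈ T → S = T)} (by
    intro c hc hchain
    refine ⟨⋃₀ c, ⟨?_, ?_⟩, fun s hs => Set.subset_sUnion_of_mem hs⟩
    · rintro S ⟨s, hs, hS⟩
      exact (hc hs).1 S hS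
    · rintro S ⟨s, hs, hS⟩ T ⟨t, ht, hT⟩
      rcases hchain.total hs ht with h | h
      · exact (hc ht).2 S (h hS) T hT
      · exact (hc hs).2 S hS T (h hT))
  refine ⟨𝓢, h𝓢.prop.1, h𝓢.prop.2, fun S hS hne hP => ?_⟩
  by_contra hcon
  have hdis : ∀ x ∈ S, ∀ T ∈ 𝓢, x ∉ T := fun x hx T hT hxT =>
    hcon ⟨x, hx, T, hT, hxT⟩
  have hmem : S ∈ 𝓢 := by
    refine h𝓢.le_of_ge (y := insert S 𝓢) ⟨?_, ?_⟩ (Set.subset_insert _ _) (Set.mem_insert _ _)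
    · rintro T (rfl | hT)
      · exact ⟨hS, hne, hP⟩
      · exact h𝓢.prop.1 T hT
    · rintro T (rfl | hT) T' (rfl | hT') x hx hx'
      · rfl
      · exact absurd hx' (hdis x hx T' hT')
      · exact absurd hx (hdis x hx' T hT)
      · exact h𝓢.prop.2 T hT T' hT' x hx hx'
  obtain ⟨x, hx⟩ := hne
  exact hdis x hx S hmem hx

theorem resolvableOn_sUnion {c : Cardinal.{u}} (𝓢 : Set (Set X))
    (hD : ∀ S ∈ 𝓢, ∀ T ∈ 𝓢, ∀ x ∈ S, x ∈ T → S = T) (h : ∀ S ∈ 𝓢, ResolvableOn c S) :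
    ResolvableOn c (⋃₀ 𝓢) := by
  rw [Set.sUnion_eq_iUnion]
  exact resolvableOn_iUnion _ (fun i j x hi hj => Subtype.ext (hD i i.2 j j.2 x hi hj))
    fun i => h i i.2

theorem resolvableOn_of_exhaustion {c : Cardinal.{u}} {Z : Set X}
    (h : ∀ U : Set X, IsOpen U → (U ∩ Z).Nonempty →
      ∃ S ⊆ U ∩ Z, S.Nonempty ∧ ResolvableOn c S) : ResolvableOn c Z := by
  obtain ⟨𝓢, h1, h2, h3⟩ := exists_maximal_disjoint (ResolvableOn c) Z
  refine (resolvableOn_sUnion 𝓢 h2 fun S hS => (h1 S hS).2.2).of_dense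
    (Set.sUnion_subset fun S hS => (h1 S hS).1) fun x hx => mem_closure_iff.2 fun U hU hxU => ?_
  obtain ⟨S, hSU, hne, hres⟩ := h U hU ⟨x, hxU, hx⟩
  obtain ⟨y, hyS, hy⟩ := h3 S (hSU.trans Set.inter_subset_right) hne hres
  exact ⟨y, (hSU hyS).1, hy⟩

theorem LocallyLarge.inter {κ : Cardinal.{u}} {Z U : Set X} (h : LocallyLarge κ Z)
    (hU : IsOpen U) : LocallyLarge κ (U ∩ Z) := by
  intro V hV hne
  rw [← Set.inter_assoc] at hne ⊢
  exact h _ (hV.inter hU) hne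

theorem LocallyLarge.inter_diff {κ : Cardinal.{u}} {Z A U : Set X} (h : LocallyLarge κ Z)
    (hκ : ℵ₀ ≤ κ) (hA : #A < κ) (hU : IsOpen U) (hne : (U ∩ Z).Nonempty) :
    κ ≤ #↑(U ∩ (Z \ A)) := by
  by_contra! hlt
  have h1 := h U hU hne
  have h2 : U ∩ Z ⊆ (U ∩ (Z \ A)) ∪ A := by
    intro x hx
    by_cases hxA : x ∈ A
    · exact Or.inr hxA
    · exact Or.inl ⟨hx.1, hx.2, hxA⟩
  exact (h1.trans ((mk_le_mk_of_subset h2).trans (mk_union_le _ _))).not_gt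
    (add_lt_of_lt hκ hlt hA)

theorem LocallyLarge.inter_diff_nonempty {κ : Cardinal.{u}} {Z A U : Set X} (h : LocallyLarge κ Z)
    (hκ : ℵ₀ ≤ κ) (hA : #A < κ) (hU : IsOpen U) (hne : (U ∩ Z).Nonempty) :
    (U ∩ (Z \ A)).Nonempty := by
  have := h.inter_diff hκ hA hU hne
  rw [← Set.nonempty_coe_sort, ← mk_ne_zero_iff]
  exact (aleph0_pos.trans_le (hκ.trans this)).ne'

theorem LocallyLarge.diff {κ : Cardinal.{u}} {Z A : Set X} (h : LocallyLarge κ Z)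
    (hκ : ℵ₀ ≤ κ) (hA : #A < κ) : LocallyLarge κ (Z \ A) :=
  fun _ hU hne => h.inter_diff hκ hA hU (hne.mono fun _ hx => ⟨hx.1, hx.2.1⟩)

theorem LocallyLarge.subset_closure_diff {κ : Cardinal.{u}} {Z A : Set X} (h : LocallyLarge κ Z)
    (hκ : ℵ₀ ≤ κ) (hA : #A < κ) : Z ⊆ closure (Z \ A) :=
  fun _ hx => mem_closure_iff.2 fun _ hU hxU => h.inter_diff_nonempty hκ hA hU ⟨_, hxU, hx⟩

end Basic

/-- There are `ν⁺` many functions on `ν` that pairwise agree on fewer than `ν` arguments. -/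
theorem exists_almost_disjoint_functions {ν : Cardinal.{u}} (hν : ℵ₀ ≤ ν) :
    ∃ f : (Order.succ ν).ord.ToType → ν.ord.ToType → ν.ord.ToType,
      ∀ i j, i ≠ j → #{γ | f i γ = f j γ} < ν := by
  obtain ⟨f, hf⟩ := exists_seq (β := ν.ord.ToType → ν.ord.ToType) (c := Order.succ ν)
    (fun _ => True) (fun _ A x => ∀ y ∈ A, #{γ | x γ = y γ} < ν) (by
      intro _ A hA _
      have hA' : #A ≤ #ν.ord.ToType := by simpa using Order.lt_succ_iff.1 hA
      obtain ⟨e⟩ := hA'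
      have hx : ∀ γ : ν.ord.ToType, ∃ t, ∀ y : A, e y < γ → t ≠ y.1 γ := by
        intro γ
        have h1 : #(Set.range fun p : {y : A // e y < γ} => p.1.1 γ) < #(Set.univ : Set ν.ord.ToType) := by
          refine mk_range_le.trans_lt ?_
          have : #{y : A // e y < γ} ≤ #(Set.Iio γ) :=
            ⟨⟨fun p => ⟨e p.1, p.2⟩, fun p q h => Subtype.ext (e.injective (congrArg Subtype.val h))⟩⟩
          refine this.trans_lt ((mk_Iio_lt γ (by simp)).trans_eq mk_univ.symm)
        obtain ⟨t, -, ht⟩ := sdiff_nonempty_of_mk_lt_mk h1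
        exact ⟨t, fun y hy h => ht ⟨⟨y, hy⟩, h.symm⟩⟩
      choose x hx using hx
      refine ⟨x, trivial, fun y hy => ?_⟩
      have : {γ | x γ = y γ} ⊆ insert (e ⟨y, hy⟩) (Set.Iio (e ⟨y, hy⟩)) := by
        intro γ hγ
        by_contra hcon
        simp only [Set.mem_insert_iff, Set.mem_Iio, not_or, not_lt] at hcon
        exact hx γ ⟨y, hy⟩ (lt_of_le_of_ne hcon.2 (Ne.symm hcon.1)) hγ
      refine (mk_le_mk_of_subset this).trans_lt (mk_insert_le.trans_lt ?_)
      exact add_lt_of_lt hν ((mk_Iio_lt _ (by simp)).trans_eq (mk_ord_toType ν))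
        (one_lt_aleph0.trans_le hν))
  refine ⟨f, fun i j hij => ?_⟩
  rcases lt_or_gt_of_ne hij with h | h
  · simpa only [eq_comm] using (hf j).2 (f i) ⟨i, h, rfl⟩
  · exact (hf i).2 (f j) ⟨j, h, rfl⟩

theorem exists_almost_disjoint_family {X : Type u} {ν : Cardinal.{u}} (hν : ℵ₀ ≤ ν) (Z : Set X)
    (hZ : ν ≤ #Z) :
    ∃ A : (Order.succ ν).ord.ToType → Set X, (∀ i, A i ⊆ Z ∧ ν ≤ #(A i)) ∧
      ∀ i j, i ≠ j → #↑(A i ∩ A j) < ν := by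
  obtain ⟨f, hf⟩ := exists_almost_disjoint_functions hν
  have hTT : #(ν.ord.ToType × ν.ord.ToType) ≤ #Z := by
    simpa [mul_eq_self hν] using hZ
  obtain ⟨e⟩ := hTT
  have hinj : Function.Injective fun p => (e p : X) := Subtype.val_injective.comp e.injective
  refine ⟨fun i => Set.range fun γ => (e (γ, f i γ) : X), fun i => ⟨?_, ?_⟩, fun i j hij => ?_⟩
  · rintro _ ⟨γ, rfl⟩
    exact (e _).2
  · rw [mk_range_eq _ fun a b h => congrArg Prod.fst (hinj h), mk_ord_toType]
  · refine lt_of_le_of_lt (le_trans (mk_le_mk_of_subset ?_)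
      (mk_image_le (f := fun γ => (e (γ, f i γ) : X)))) (hf i j hij)
    rintro _ ⟨⟨γ, rfl⟩, ⟨δ, h⟩⟩
    have := hinj h
    simp only [Prod.mk.injEq] at this
    exact ⟨γ, by rw [Set.mem_ofPred_eq, ← this.2, this.1], rfl⟩

section Spread

variable {X : Type u} [TopologicalSpace X]

/-- In a space of countable spread, a family of points separated by open sets is countable. -/
theorem countable_of_discrete_points (hs : ∀ D : Set X, DiscreteTopology D → D.Countable)
    {ι : Type*} (w : ι → X) (U : ι → Set X) (hU : ∀ i, IsOpen (U i)) (hw : ∀ i, w i ∈ U i)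
    (h : ∀ i j, w j ∈ U i → i = j) : Countable ι := by
  have hinj : Function.Injective w := fun i j hij => h i j (hij ▸ hw i)
  have := hs (Set.range w) (discreteTopology_subtype_iff'.2 (by
    rintro _ ⟨i, rfl⟩
    refine ⟨U i, hU i, Set.Subset.antisymm ?_ ?_⟩
    · rintro _ ⟨hx, j, rfl⟩
      rw [h i j hx]; rfl
    · rintro _ rfl
      exact ⟨hw i, i, rfl⟩))
  rw [← Set.image_univ] at this
  exact Set.countable_univ_iff.1 (Set.countable_of_injective_of_countable_image hinj.injOn this)

theorem mk_inter_closure_lt_of_leftSeparated {ν : Cardinal.{u}} (hν : ν.IsRegular)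
    (z : ν.ord.ToType → X) (hz : ∀ a, z a ∉ closure (z '' Set.Iio a)) (A : Set X)
    (hA : A ⊆ Set.range z) (hAν : #A < ν) : #↑(Set.range z ∩ closure A) < ν := by
  have hinj : Function.Injective z := by
    intro a b hab
    by_contra hne
    rcases lt_or_gt_of_ne hne with h | h
    · exact hz b (subset_closure ⟨a, h, hab⟩)
    · exact hz a (subset_closure ⟨b, h, hab.symm⟩)
  have hcof : ¬ IsCofinal (z ⁻¹' A) := by
    intro h
    have := Order.cof_le h
    rw [Ordinal.cof_toType, hν.cof_ord] at this
    exact (this.trans (mk_preimage_of_injective z A hinj)).not_gt hAν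
  rw [not_isCofinal_iff] at hcof
  obtain ⟨γ, hγ⟩ := hcof
  have h1 : Set.range z ∩ closure A ⊆ z '' Set.Iio γ := by
    rintro _ ⟨⟨a, rfl⟩, ha⟩
    refine ⟨a, ?_, rfl⟩
    by_contra hlt
    refine hz a (closure_mono ?_ ha)
    intro y hy
    obtain ⟨b, rfl⟩ := hA hy
    exact ⟨b, lt_of_lt_of_le (by simpa using hγ b hy) (by simpa using hlt), rfl⟩
  exact (mk_le_mk_of_subset h1).trans_lt
    (mk_image_le.trans_lt ((mk_Iio_lt γ (by simp)).trans_eq (mk_ord_toType ν)))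

/-- A set has few points at which it is locally of size less than `ν`. -/
theorem mk_locally_small_lt (hs : ∀ D : Set X, DiscreteTopology D → D.Countable)
    {ν : Cardinal.{u}} (hν : ν.IsRegular) (hν0 : ℵ₀ < ν) (Z : Set X)
    (hZ : ∀ A ⊆ Z, #A < ν → #↑(Z ∩ closure A) < ν) (W : Set X) (hW : W ⊆ Z) :
    #{x | x ∈ W ∧ ∃ U, IsOpen U ∧ x ∈ U ∧ #↑(U ∩ W) < ν} < ν := by
  by_contra! hL
  set L := {x | x ∈ W ∧ ∃ U, IsOpen U ∧ x ∈ U ∧ #↑(U ∩ W) < ν} with hLdef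
  have hLW : ∀ x : L, ∃ U, IsOpen U ∧ x.1 ∈ U ∧ #↑(U ∩ W) < ν := fun x => x.2.2
  choose U hUo hxU hUν using hLW
  obtain ⟨w, hw⟩ := exists_seq (β := L) (c := ν) (fun _ => True)
    (fun _ A x => x.1 ∉ closure (Subtype.val '' A) ∧ ∀ y ∈ A, x.1 ∉ U y) (by
      intro _ A hA _
      have hA1 : #↑(Subtype.val '' A : Set X) < ν := mk_image_le.trans_lt hA
      have hbad : #↑((Z ∩ closure (Subtype.val '' A)) ∪ ⋃ y ∈ A, (U y ∩ W) : Set X) < #L := by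
        refine lt_of_lt_of_le ((mk_union_le _ _).trans_lt (add_lt_of_lt hν0.le ?_ ?_)) hL
        · refine hZ _ ?_ hA1
          rintro _ ⟨y, -, rfl⟩
          exact hW y.2.1
        · exact (card_biUnion_lt_iff_forall_of_isRegular hν hA).2 fun y _ => hUν y
      obtain ⟨x, hxL, hx⟩ := sdiff_nonempty_of_mk_lt_mk hbad
      simp only [Set.mem_union, Set.mem_inter_iff, Set.mem_iUnion, not_or, not_and, not_exists] at hx
      exact ⟨⟨x, hxL⟩, trivial, hx.1 (hW hxL.1), fun y hy h => hx.2 y hy h hxL.1⟩)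
  have : Countable ν.ord.ToType := by
    refine countable_of_discrete_points hs (fun a => (w a).1)
      (fun a => U (w a) ∩ (closure (Subtype.val '' (w '' Set.Iio a)))ᶜ)
      (fun a => (hUo _).inter isClosed_closure.isOpen_compl)
      (fun a => ⟨hxU _, (hw a).2.1⟩) ?_
    rintro a b ⟨h1, h2⟩
    by_contra hne
    rcases lt_or_gt_of_ne hne with h | h
    · exact (hw b).2.2 _ ⟨a, h, rfl⟩ h1
    · exact h2 (subset_closure ⟨_, ⟨b, h, rfl⟩, rfl⟩)
  rw [← mk_le_aleph0_iff, mk_ord_toType] at this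
  exact this.not_gt hν0

/-- If all subsets of a set of regular size have few locally small points, some nonempty subset
is resolvable. -/
theorem exists_resolvableOn_of_locally_small {ν : Cardinal.{u}} (hν : ν.IsRegular) (Z : Set X)
    (hZν : #Z = ν)
    (hsmall : ∀ W ⊆ Z, #{x | x ∈ W ∧ ∃ U, IsOpen U ∧ x ∈ U ∧ #↑(U ∩ W) < ν} < ν) :
    ∃ S ⊆ Z, S.Nonempty ∧ ResolvableOn ν S := by
  have hν0 := hν.aleph0_le
  obtain ⟨A, hA, hAd⟩ := exists_almost_disjoint_family hν0 Z hZν.ge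
  set B : (Order.succ ν).ord.ToType → Set X :=
    fun i => {x | x ∈ A i ∧ ∀ U, IsOpen U → x ∈ U → ν ≤ #↑(U ∩ A i)} with hBdef
  have hBA : ∀ i, B i ⊆ A i := fun i x hx => hx.1
  have hAB : ∀ i, #↑(A i \ B i) < ν := by
    intro i
    refine (mk_le_mk_of_subset ?_).trans_lt (hsmall (A i) (hA i).1)
    rintro x ⟨hx, hxB⟩
    refine ⟨hx, ?_⟩
    by_contra! hcon
    exact hxB ⟨hx, hcon⟩
  have hB : ∀ i, ∀ x ∈ B i, ∀ U, IsOpen U → x ∈ U → ν ≤ #↑(U ∩ B i) := by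
    intro i x hx U hU hxU
    by_contra! hlt
    have h1 : U ∩ A i ⊆ (U ∩ B i) ∪ (A i \ B i) := by
      intro y hy
      by_cases hyB : y ∈ B i
      · exact Or.inl ⟨hy.1, hyB⟩
      · exact Or.inr ⟨hy.2, hyB⟩
    exact ((hx.2 U hU hxU).trans ((mk_le_mk_of_subset h1).trans (mk_union_le _ _))).not_gt
      (add_lt_of_lt hν0 hlt (hAB i))
  have hBne : ∀ i, (B i).Nonempty := by
    intro i
    obtain ⟨x, hx, hx'⟩ := sdiff_nonempty_of_mk_lt_mk ((hAB i).trans_le (hA i).2)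
    by_contra hne
    exact hx' ⟨hx, fun hxB => hne ⟨x, hxB⟩⟩
  set N : X → Set (Order.succ ν).ord.ToType :=
    fun x => {i | ∀ U, IsOpen U → x ∈ U → ν ≤ #↑(U ∩ B i)} with hNdef
  set S : Set X := {x | x ∈ Z ∧ Order.succ ν ≤ #(N x)} with hSdef
  set J : Set (Order.succ ν).ord.ToType := ⋃ x : (Z \ S : Set X), N x with hJdef
  have hsucc : ℵ₀ ≤ Order.succ ν := hν0.trans (Order.le_succ ν)
  have hJ : #J < Order.succ ν := by
    refine (card_iUnion_lt_iff_forall_of_isRegular (isRegular_succ hν0) ?_).2 ?_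
    · exact ((mk_le_mk_of_subset Set.sdiff_subset).trans_eq hZν).trans_lt (Order.lt_succ ν)
    · rintro ⟨x, hxZ, hxS⟩
      by_contra! hcon
      exact hxS ⟨hxZ, hcon⟩
  have hBS : ∀ i ∉ J, B i ⊆ S := by
    intro i hi x hx
    by_contra hxS
    exact hi (Set.mem_iUnion.2 ⟨⟨x, (hA i).1 hx.1, hxS⟩, hB i x hx⟩)
  obtain ⟨i₀, -, hi₀⟩ := sdiff_nonempty_of_mk_lt_mk
    (hJ.trans_eq ((mk_ord_toType _).symm.trans mk_univ.symm))
  have hSne : S.Nonempty := (hBne i₀).mono (hBS i₀ hi₀)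
  have hSZ : S ⊆ Z := fun x hx => hx.1
  refine ⟨S, hSZ, hSne, ?_⟩
  have hle : #(S × ν.ord.ToType) ≤ #ν.ord.ToType := by
    rw [mk_prod, lift_id, lift_id, mk_ord_toType]
    exact (mul_le_mul_left ((mk_le_mk_of_subset hSZ).trans_eq hZν) ν).trans_eq (mul_eq_self hν0)
  have : Nonempty (S × ν.ord.ToType) := by
    have h2 : Nonempty ν.ord.ToType := by
      rw [← mk_ne_zero_iff, mk_ord_toType]
      exact (aleph0_pos.trans_le hν0).ne'
    exact ⟨⟨hSne.choose, hSne.choose_spec⟩, h2.some⟩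
  obtain ⟨e⟩ := hle
  set q := Function.invFun e with hq
  have hqs : Function.Surjective q := Function.invFun_surjective e.injective
  obtain ⟨i, hi⟩ := exists_seq (β := (Order.succ ν).ord.ToType) (c := ν) (fun i => i ∉ J)
    (fun a A i => i ∈ N (q a).1 ∧ i ∉ A) (by
      intro a A hA _
      have h1 : #↑(J ∪ A) < #(N (q a).1) :=
        ((mk_union_le _ _).trans_lt (add_lt_of_lt hsucc hJ (hA.trans (Order.lt_succ ν)))).trans_le
          (q a).1.2.2
      obtain ⟨i, hi, hi'⟩ := sdiff_nonempty_of_mk_lt_mk h1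
      exact ⟨i, fun h => hi' (Or.inl h), hi, fun h => hi' (Or.inr h)⟩)
  have hine : ∀ a b, b < a → i a ≠ i b := fun a b hab h => (hi a).2.2 ⟨b, hab, h.symm⟩
  set C : ν.ord.ToType → Set X := fun a => B (i a) \ ⋃ b : Set.Iio a, A (i b) with hC
  have hCd : ∀ a b, ∀ x ∈ C a, x ∈ C b → a = b := by
    intro a b x ha hb
    by_contra hne
    rcases lt_or_gt_of_ne hne with h | h
    · exact hb.2 (Set.mem_iUnion.2 ⟨⟨a, h⟩, hBA _ ha.1⟩)
    · exact ha.2 (Set.mem_iUnion.2 ⟨⟨b, h⟩, hBA _ hb.1⟩)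
  have hCcl : ∀ a, (q a).1.1 ∈ closure (C a) := by
    intro a
    refine mem_closure_iff.2 fun U hU hxU => ?_
    have h1 := (hi a).2.1 U hU hxU
    have h2 : #↑(⋃ b : Set.Iio a, (A (i a) ∩ A (i b))) < ν := by
      refine (card_iUnion_lt_iff_forall_of_isRegular hν
        ((mk_Iio_lt a (by simp)).trans_eq (mk_ord_toType ν))).2 fun b => hAd _ _ (hine a b b.2)
    obtain ⟨y, hy, hy'⟩ := sdiff_nonempty_of_mk_lt_mk (h2.trans_le h1)
    refine ⟨y, hy.1, hy.2, fun hyb => hy' ?_⟩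
    obtain ⟨b, hb⟩ := Set.mem_iUnion.1 hyb
    exact Set.mem_iUnion.2 ⟨b, hBA _ hy.2, hb⟩
  obtain ⟨g, hg⟩ := exists_glue C hCd
    (fun a _ => (Ordinal.ToType.mk.symm (q a).2 : Ordinal.{u}))
  refine ⟨g, fun k hk x hx => ?_⟩
  obtain ⟨a, ha⟩ := hqs (⟨x, hx⟩, Ordinal.ToType.mk ⟨k, hk⟩)
  have := hCcl a
  rw [ha] at this
  refine closure_mono (fun y hy => ?_) this
  refine ⟨hBS _ (hi a).1 hy.1, ?_⟩
  rw [hg a y hy, ha]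
  simp

theorem exists_resolvableOn_of_leftSeparated
    (hs : ∀ D : Set X, DiscreteTopology D → D.Countable)
    {ν : Cardinal.{u}} (hν : ν.IsRegular) (hν0 : ℵ₀ < ν)
    (z : ν.ord.ToType → X) (hz : ∀ a, z a ∉ closure (z '' Set.Iio a)) :
    ∃ S ⊆ Set.range z, S.Nonempty ∧ ResolvableOn ν S := by
  have hinj : Function.Injective z := by
    intro a b hab
    by_contra hne
    rcases lt_or_gt_of_ne hne with h | h
    · exact hz b (subset_closure ⟨a, h, hab⟩)
    · exact hz a (subset_closure ⟨b, h, hab.symm⟩)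
  refine exists_resolvableOn_of_locally_small hν _
    ((mk_range_eq z hinj).trans (mk_ord_toType ν)) fun W hW =>
    mk_locally_small_lt hs hν hν0 (Set.range z) (fun A hA hAν =>
      mk_inter_closure_lt_of_leftSeparated hν z hz A hA hAν) W hW

/-- The dichotomy between resolvable subsets and hereditarily small density. -/
theorem exists_resolvableOn_or_density_lt
    (hs : ∀ D : Set X, DiscreteTopology D → D.Countable)
    {ν : Cardinal.{u}} (hν : ν.IsRegular) (hν0 : ℵ₀ < ν) (Y : Set X)
    (hY : ∀ S ⊆ Y, S.Nonempty → #S ≤ ν → ¬ ResolvableOn ν S) :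
    ∀ Z ⊆ Y, ∃ M ⊆ Z, #M < ν ∧ Z ⊆ closure M := by
  intro Z hZ
  by_contra! hcon
  obtain ⟨z, hz⟩ := exists_seq (β := X) (c := ν) (fun x => x ∈ Z)
    (fun _ A x => x ∉ closure A) (by
      intro _ A hA hAZ
      obtain ⟨x, hx, hx'⟩ := Set.not_subset.1 (hcon A hAZ hA)
      exact ⟨x, hx, hx'⟩)
  obtain ⟨S, hS, hne, hres⟩ := exists_resolvableOn_of_leftSeparated hs hν hν0 z fun a => (hz a).2
  have hrange : Set.range z ⊆ Z := by
    rintro _ ⟨a, rfl⟩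
    exact (hz a).1
  exact hY S (hS.trans (hrange.trans hZ)) hne ((mk_le_mk_of_subset hS).trans
    (mk_range_le.trans_eq (mk_ord_toType ν))) hres

end Spread

theorem mk_sUnion_lt_of_regular {X : Type u} {κ : Cardinal.{u}} (hκ : κ.IsRegular)
    (𝒜 : Set (Set X)) (h𝒜 : #𝒜 < κ) (h : ∀ a ∈ 𝒜, #a < κ) : #↑(⋃₀ 𝒜) < κ := by
  rw [Set.sUnion_eq_iUnion]
  exact (card_iUnion_lt_iff_forall_of_isRegular hκ h𝒜).2 fun a => h a a.2

theorem mk_sUnion_lt_of_lt {X : Type u} {κ ν : Cardinal.{u}} (hκ : ℵ₀ ≤ κ) (hν : ν < κ)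
    (𝒜 : Set (Set X)) (h𝒜 : #𝒜 < κ) (h : ∀ a ∈ 𝒜, #a ≤ ν) : #↑(⋃₀ 𝒜) < κ :=
  (mk_sUnion_le 𝒜).trans_lt ((mul_le_mul_right (ciSup_le' fun a : 𝒜 => h a a.2) _).trans_lt
    (mul_lt_of_lt hκ h𝒜 hν))

theorem mk_sUnion_lt_of_lt_cof {X : Type u} {κ : Cardinal.{u}} (hκ : ℵ₀ ≤ κ)
    (𝒜 : Set (Set X)) (h𝒜 : #𝒜 < κ.ord.cof) (h : ∀ a ∈ 𝒜, #a < κ) : #↑(⋃₀ 𝒜) < κ := by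
  have h1 : ⨆ a : 𝒜, #a.1 < κ := iSup_lt_of_lt_cof_ord h𝒜 fun a => h a a.2
  refine mk_sUnion_lt_of_lt hκ h1 𝒜 (h𝒜.trans_le ?_) fun a ha =>
    le_ciSup (f := fun a : 𝒜 => #a.1) bddAbove_of_small ⟨a, ha⟩
  exact Ordinal.cof_ord_le κ

theorem exists_cofinal_regular {κ : Cardinal.{u}} (hκ : κ.IsSingular) (ι : Type u)
    (hι : #ι = κ.ord.cof) :
    ∃ l : ι → Cardinal.{u}, (∀ i, (l i).IsRegular ∧ ℵ₀ < l i ∧ l i < κ) ∧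
      ∀ k < κ.ord, ∃ i, k < (l i).ord := by
  obtain ⟨s, hs, hcard⟩ := Order.exists_cof_eq κ.ord.ToType
  rw [Ordinal.cof_toType, ← hι] at hcard
  obtain ⟨e⟩ := Cardinal.eq.1 hcard
  have hlim := hκ.isSuccLimit
  have hω : ℵ₀ < κ := by
    rcases hκ.aleph0_le.lt_or_eq with h | h
    · exact h
    · exact absurd (h ▸ isRegular_aleph0) hκ.not_isRegular
  let v : ι → Ordinal.{u} := fun i => (Ordinal.ToType.mk.symm (e.symm i).1 : Ordinal.{u})
  have hv : ∀ i, v i < κ.ord := fun i => (Ordinal.ToType.mk.symm (e.symm i).1).2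
  refine ⟨fun i => Order.succ (max ℵ₀ (v i).card), fun i => ⟨?_, ?_, ?_⟩, fun k hk => ?_⟩
  · exact isRegular_succ (le_max_left _ _)
  · exact Order.lt_succ_iff.2 (le_max_left _ _)
  · exact hlim.succ_lt (max_lt hω (lt_ord.1 (hv i)))
  · obtain ⟨b, hb, hkb⟩ := hs (Ordinal.ToType.mk ⟨k, hk⟩)
    refine ⟨e ⟨b, hb⟩, ?_⟩
    have h1 : k ≤ v (e ⟨b, hb⟩) := by
      simp only [v, Equiv.symm_apply_apply]
      have := Ordinal.ToType.mk.symm.monotone hkb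
      rw [OrderIso.symm_apply_apply] at this
      exact this
    exact lt_ord.2 ((Ordinal.card_le_card h1).trans_lt
      ((le_max_right _ _).trans_lt (Order.lt_succ _)))

section Spread

variable {X : Type u} [TopologicalSpace X]

theorem resolvableOn_of_density_lt {κ ν : Cardinal.{u}} {Z : Set X} (hκ : ℵ₀ ≤ κ)
    (hZ : LocallyLarge κ Z) (hd : ∀ W ⊆ Z, ∃ M ⊆ W, #M < ν ∧ W ⊆ closure M)
    (hsum : ∀ 𝒜 : Set (Set X), #𝒜 < κ → (∀ a ∈ 𝒜, #a < ν) → #↑(⋃₀ 𝒜) < κ) :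
    ResolvableOn κ Z := by
  obtain ⟨D, hD⟩ := exists_seq (β := Set X) (c := κ)
    (fun D => D ⊆ Z ∧ #D < ν ∧ Z ⊆ closure D) (fun _ 𝒜 D => ∀ x ∈ D, x ∉ ⋃₀ 𝒜) (by
      intro _ 𝒜 h𝒜 hP
      obtain ⟨M, hM, hMν, hMd⟩ := hd (Z \ ⋃₀ 𝒜) Set.sdiff_subset
      refine ⟨M, ⟨hM.trans Set.sdiff_subset, hMν, ?_⟩, fun x hx => (hM hx).2⟩
      exact (hZ.subset_closure_diff hκ (hsum 𝒜 h𝒜 fun a ha => (hP a ha).2.1)).trans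
        (closure_minimal hMd isClosed_closure))
  have hlt : ∀ i j, i < j → ∀ x ∈ D i, x ∉ D j := fun i j hij x hi hj =>
    (hD j).2 x hj ⟨_, ⟨i, hij, rfl⟩, hi⟩
  refine resolvableOn_of_family (mk_ord_toType κ).ge D (fun i => (hD i).1.1)
    (fun i => (hD i).1.2.2) fun i j x hi hj => ?_
  by_contra hne
  rcases lt_or_gt_of_ne hne with h | h
  · exact hlt _ _ h x hi hj
  · exact hlt _ _ h x hj hi

theorem LocallyLarge.mono {κ ν : Cardinal.{u}} {Z : Set X} (h : LocallyLarge κ Z) (hν : ν ≤ κ) :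
    LocallyLarge ν Z := fun U hU hne => hν.trans (h U hU hne)

/-- Resolvability at regular cardinals. -/
theorem LocallyLarge.resolvableOn_of_isRegular
    (hs : ∀ D : Set X, DiscreteTopology D → D.Countable)
    {ν : Cardinal.{u}} (hν : ν.IsRegular) (hν0 : ℵ₀ < ν) {Z : Set X} (hZ : LocallyLarge ν Z) :
    ResolvableOn ν Z := by
  refine resolvableOn_of_exhaustion fun U hU hne => ?_
  by_cases h : ∃ S ⊆ U ∩ Z, S.Nonempty ∧ #S ≤ ν ∧ ResolvableOn ν S
  · obtain ⟨S, hS, hSne, -, hres⟩ := h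
    exact ⟨S, hS, hSne, hres⟩
  · push Not at h
    exact ⟨_, subset_rfl, hne, resolvableOn_of_density_lt hν0.le (hZ.inter hU)
      (exists_resolvableOn_or_density_lt hs hν hν0 _ h) (mk_sUnion_lt_of_regular hν)⟩

/-- A locally large set contains a dense `ν`-resolvable set with locally large complement. -/
theorem LocallyLarge.exists_dense_resolvableOn
    (hs : ∀ D : Set X, DiscreteTopology D → D.Countable)
    {κ ν : Cardinal.{u}} (hν : ν.IsRegular) (hν0 : ℵ₀ < ν) (hνκ : ν ≤ κ) {Y : Set X}
    (hY : LocallyLarge κ Y) :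
    ∃ D ⊆ Y, Y ⊆ closure D ∧ ResolvableOn ν D ∧ LocallyLarge κ (Y \ D) ∧
      Y ⊆ closure (Y \ D) := by
  have hκ : ℵ₀ ≤ κ := hν0.le.trans hνκ
  obtain ⟨f, hf⟩ := (hY.mono hνκ).resolvableOn_of_isRegular hs hν hν0
  have hTT : #(ν.ord.ToType ⊕ ν.ord.ToType) ≤ #ν.ord.ToType := by
    simp [add_eq_self hν0.le]
  obtain ⟨e⟩ := hTT
  set c : ν.ord.ToType ⊕ ν.ord.ToType → Ordinal.{u} :=
    fun t => (Ordinal.ToType.mk.symm (e t) : Ordinal.{u}) with hc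
  have hcinj : Function.Injective c := fun s t h =>
    e.injective (Ordinal.ToType.mk.symm.injective (Subtype.ext h))
  have hclt : ∀ t, c t < ν.ord := fun t => (Ordinal.ToType.mk.symm (e t)).2
  set A : Set X := {x | x ∈ Y ∧ ∃ t, f x = c (Sum.inl t)} with hA
  set N : Set X := ⋃₀ {V | IsOpen V ∧ #↑(V ∩ (Y \ A)) < κ} with hN
  have hNo : IsOpen N := isOpen_sUnion fun V hV => hV.1
  set E : ν.ord.ToType → Set X := fun t =>
    {x | x ∈ Y ∧ f x = c (Sum.inl t) ∧ x ∉ N} ∪ {x | x ∈ Y ∧ f x = c (Sum.inr t) ∧ x ∈ N} with hE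
  set D : Set X := (A \ N) ∪ ((Y \ A) ∩ N) with hD
  have hDY : D ⊆ Y := by
    rintro x (hx | hx)
    · exact hx.1.1
    · exact hx.1.1
  have hED : ∀ t, E t ⊆ D := by
    rintro t x (⟨hxY, hx, hxN⟩ | ⟨hxY, hx, hxN⟩)
    · exact Or.inl ⟨⟨hxY, t, hx⟩, hxN⟩
    · refine Or.inr ⟨⟨hxY, ?_⟩, hxN⟩
      rintro ⟨-, s, hs⟩
      exact absurd (hcinj (hs.symm.trans hx)) (by simp)
  have hEd : ∀ t, Y ⊆ closure (E t) := by
    intro t x hx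
    refine mem_closure_iff.2 fun U hU hxU => ?_
    by_cases hUN : ∃ y ∈ Y, y ∈ U ∧ y ∈ N
    · obtain ⟨y, hyY, hyU, hyN⟩ := hUN
      obtain ⟨w, hw, hwY, hwf⟩ := mem_closure_iff.1 (hf _ (hclt (Sum.inr t)) hyY) (U ∩ N)
        (hU.inter hNo) ⟨hyU, hyN⟩
      exact ⟨w, hw.1, Or.inr ⟨hwY, hwf, hw.2⟩⟩
    · push Not at hUN
      obtain ⟨w, hw, hwY, hwf⟩ := mem_closure_iff.1 (hf _ (hclt (Sum.inl t)) hx) U hU hxU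
      exact ⟨w, hw, Or.inl ⟨hwY, hwf, hUN w hwY hw⟩⟩
  have hEdisj : ∀ s t, ∀ x ∈ E s, x ∈ E t → s = t := by
    rintro s t x (⟨-, hx, hxN⟩ | ⟨-, hx, hxN⟩) (⟨-, hy, hyN⟩ | ⟨-, hy, hyN⟩)
    · exact Sum.inl_injective (hcinj (hx.symm.trans hy))
    · exact absurd hyN hxN
    · exact absurd hxN hyN
    · exact Sum.inr_injective (hcinj (hx.symm.trans hy))
  have hDcl : Y ⊆ closure D := by
    have : Nonempty ν.ord.ToType := by
      rw [← mk_ne_zero_iff, mk_ord_toType]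
      exact (aleph0_pos.trans hν0).ne'
    exact (hEd this.some).trans (closure_mono (hED _))
  have key : ∀ V, IsOpen V → (V ∩ Y).Nonempty → κ ≤ #↑(V ∩ (Y \ D)) := by
    intro V hV hne
    by_cases hVN : ∃ y ∈ Y, y ∈ V ∧ y ∈ N
    · obtain ⟨y, hyY, hyV, W, ⟨hWo, hW⟩, hyW⟩ := hVN
      have h1 := hY (V ∩ W) (hV.inter hWo) ⟨y, ⟨hyV, hyW⟩, hyY⟩
      have h2 : V ∩ W ∩ Y ⊆ (V ∩ (Y \ D)) ∪ (W ∩ (Y \ A)) := by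
        rintro x ⟨⟨hxV, hxW⟩, hxY⟩
        by_cases hxA : x ∈ A
        · refine Or.inl ⟨hxV, hxY, ?_⟩
          rintro (h | h)
          · exact h.2 ⟨W, ⟨hWo, hW⟩, hxW⟩
          · exact h.1.2 hxA
        · exact Or.inr ⟨hxW, hxY, hxA⟩
      by_contra! hlt
      exact (h1.trans ((mk_le_mk_of_subset h2).trans (mk_union_le _ _))).not_gt
        (add_lt_of_lt hκ hlt hW)
    · push Not at hVN
      by_contra! hlt
      have h2 : V ∩ (Y \ A) ⊆ V ∩ (Y \ D) := by
        rintro x ⟨hxV, hxY, hxA⟩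
        refine ⟨hxV, hxY, ?_⟩
        rintro (h | h)
        · exact hxA h.1
        · exact hVN x hxY hxV h.2
      obtain ⟨y, hyV, hyY⟩ := hne
      exact hVN y hyY hyV ⟨V, ⟨hV, (mk_le_mk_of_subset h2).trans_lt hlt⟩, hyV⟩
  refine ⟨D, hDY, hDcl, ?_, fun V hV hne => key V hV (hne.mono fun x hx => ⟨hx.1, hx.2.1⟩), ?_⟩
  · exact resolvableOn_of_family (mk_ord_toType ν).ge E hED (fun t => hDY.trans (hEd t)) hEdisj
  · intro x hx
    refine mem_closure_iff.2 fun V hV hxV => ?_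
    have := key V hV ⟨x, hxV, hx⟩
    rw [← Set.nonempty_coe_sort, ← mk_ne_zero_iff]
    exact (aleph0_pos.trans_le (hκ.trans this)).ne'

theorem LocallyLarge.resolvableOn_of_cof_eq_aleph0
    (hs : ∀ D : Set X, DiscreteTopology D → D.Countable)
    {κ : Cardinal.{u}} (hκ : κ.IsSingular) (hcof : κ.ord.cof = ℵ₀) {Z : Set X}
    (hZ : LocallyLarge κ Z) : ResolvableOn κ Z := by
  obtain ⟨l, hl, hlc⟩ := exists_cofinal_regular hκ (ULift.{u} ℕ) (by simp [hcof])
  have step : ∀ n : ℕ, ∀ Y : {Y : Set X // LocallyLarge κ Y ∧ Z ⊆ closure Y},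
      ∃ D : Set X, D ⊆ Y.1 ∧ Z ⊆ closure D ∧ ResolvableOn (l ⟨n⟩) D ∧
        LocallyLarge κ (Y.1 \ D) ∧ Z ⊆ closure (Y.1 \ D) := by
    rintro n ⟨Y, hY, hYZ⟩
    obtain ⟨D, h1, h2, h3, h4, h5⟩ :=
      hY.exists_dense_resolvableOn hs (hl ⟨n⟩).1 (hl ⟨n⟩).2.1 (hl ⟨n⟩).2.2.le
    exact ⟨D, h1, hYZ.trans (closure_minimal h2 isClosed_closure), h3, h4,
      hYZ.trans (closure_minimal h5 isClosed_closure)⟩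
  choose D hDY hDc hDr hDl hDd using step
  let Y : ℕ → {Y : Set X // LocallyLarge κ Y ∧ Z ⊆ closure Y} := fun n =>
    Nat.rec ⟨Z, hZ, subset_closure⟩ (fun n Y => ⟨Y.1 \ D n Y, hDl n Y, hDd n Y⟩) n
  have hYs : ∀ n, (Y (n + 1)).1 = (Y n).1 \ D n (Y n) := fun n => rfl
  have hanti : Antitone fun n => (Y n).1 := antitone_nat_of_succ_le fun n => by
    rw [hYs]; exact Set.sdiff_subset
  have hlt : ∀ m n, m < n → ∀ x ∈ D m (Y m), x ∉ D n (Y n) := by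
    intro m n hmn x hm hn
    have := hanti (Nat.succ_le_of_lt hmn) (hDY n _ hn)
    simp only [Nat.succ_eq_add_one, hYs] at this
    exact this.2 hm
  refine resolvableOn_of_cofinal (fun i : ULift.{u} ℕ => D i.down (Y i.down)) ?_ ?_ l
    (fun i => hDr i.down _) fun k hk => ?_
  · rintro ⟨m⟩ ⟨n⟩ x hm hn
    by_contra hne
    have hne' : m ≠ n := fun h => hne (congrArg ULift.up h)
    rcases lt_or_gt_of_ne hne' with h | h
    · exact hlt _ _ h x hm hn
    · exact hlt _ _ h x hn hm
  · intro i
    exact (hDY i.down _).trans (hanti (Nat.zero_le i.down))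
  · obtain ⟨i, hi⟩ := hlc k hk
    exact ⟨i, hi, hDc i.down _⟩

end Spread

/-- A set of singular cardinality splits into few pieces of smaller cardinality. -/
theorem exists_small_pieces {X : Type u} (W : Set X) (hW : (#W).IsSingular) (ι : Type u)
    (hι : #ι = (#W).ord.cof) : ∃ p : X → ι, ∀ i, #{x | x ∈ W ∧ p x = i} < #W := by
  classical
  obtain ⟨l, hl, hlc⟩ := exists_cofinal_regular hW ι hι
  obtain ⟨e⟩ := Cardinal.eq.1 (mk_ord_toType #W)
  let v : W → Ordinal.{u} := fun x => (Ordinal.ToType.mk.symm (e.symm x) : Ordinal.{u})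
  have hv : ∀ x, v x < (#W).ord := fun x => (Ordinal.ToType.mk.symm (e.symm x)).2
  have hvinj : Function.Injective v := fun x y h =>
    e.symm.injective (Ordinal.ToType.mk.symm.injective (Subtype.ext h))
  choose q hq using fun x : W => hlc (v x) (hv x)
  have hne : Nonempty ι := by
    obtain ⟨i, -⟩ := hlc 0 (by
      rw [lt_ord, Ordinal.card_zero]
      exact aleph0_pos.trans_le hW.aleph0_le)
    exact ⟨i⟩
  refine ⟨fun x => if h : x ∈ W then q ⟨x, h⟩ else hne.some, fun i => ?_⟩
  refine lt_of_le_of_lt ?_ (hl i).2.2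
  rw [← mk_ord_toType (l i)]
  refine ⟨⟨fun x => Ordinal.ToType.mk ⟨v ⟨x.1, x.2.1⟩, ?_⟩, fun x y h => ?_⟩⟩
  · have h1 := hq ⟨x.1, x.2.1⟩
    have h2 := x.2.2
    simp only [dif_pos x.2.1] at h2
    rw [h2] at h1
    exact h1
  · have h1 := Ordinal.ToType.mk.injective h
    have h2 := hvinj (Subtype.mk.inj h1)
    exact Subtype.ext (Subtype.mk.inj h2)

section Spread

variable {X : Type u} [TopologicalSpace X]

theorem ResolvableOn.union {c : Cardinal.{u}} {A B : Set X} (hA : ResolvableOn c A)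
    (hB : ResolvableOn c B) (h : ∀ x ∈ A, x ∉ B) : ResolvableOn c (A ∪ B) := by
  rw [Set.union_eq_iUnion]
  refine resolvableOn_iUnion _ ?_ ?_
  · rintro (_ | _) (_ | _) x hi hj
    · rfl
    · exact absurd hi (h x hj)
    · exact absurd hj (h x hi)
    · rfl
  · rintro (_ | _)
    · exact hB
    · exact hA

/-- A ranking of `W` by cardinals whose fibres are resolvable and whose sublevels are small. -/
def IsRanking (W : Set X) (r : X → Cardinal.{u}) : Prop :=
  (∀ ν, ℵ₀ ≤ ν → #{x | x ∈ W ∧ r x ≤ ν} ≤ ν) ∧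
    ∀ ν, ℵ₀ < ν → ResolvableOn ν {x | x ∈ W ∧ r x = ν}

/-- Rankings exist whenever all subsets of `Y` of regular size contain resolvable subsets. -/
theorem exists_isRanking (Y : Set X)
    (hY : ∀ ν : Cardinal.{u}, ν.IsRegular → ℵ₀ < ν → ∀ W ⊆ Y, ν ≤ #W →
      ∃ S ⊆ W, S.Nonempty ∧ ResolvableOn ν S) (W : Set X) (hWY : W ⊆ Y) :
    ∃ r, IsRanking W r := by
  classical
  induction hμ : #W using WellFoundedLT.induction generalizing W with
  | ind μ ih =>
  rcases le_or_gt μ ℵ₀ with hμ0 | hμ0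
  · refine ⟨fun _ => ℵ₀, fun ν hν => ?_, fun ν hν => ?_⟩
    · exact (mk_le_mk_of_subset fun x hx => hx.1).trans (hμ.le.trans (hμ0.trans hν))
    · convert resolvableOn_empty ν
      exact Set.eq_empty_of_forall_notMem fun x hx => hν.ne hx.2
  rcases isRegular_or_isSingular hμ0.le with hreg | hsing
  · obtain ⟨𝓢, h1, h2, h3⟩ := exists_maximal_disjoint (ResolvableOn μ) W
    have hC : #↑(W \ ⋃₀ 𝓢) < μ := by
      by_contra! hle
      obtain ⟨S, hS, hne, hres⟩ := hY μ hreg hμ0 _ (Set.sdiff_subset.trans hWY) hle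
      obtain ⟨x, hx, hx'⟩ := h3 S (hS.trans Set.sdiff_subset) hne hres
      exact (hS hx).2 hx'
    obtain ⟨r, hr1, hr2⟩ := ih _ hC _ (Set.sdiff_subset.trans hWY) rfl
    have hKW : ⋃₀ 𝓢 ⊆ W := Set.sUnion_subset fun S hS => (h1 S hS).1
    refine ⟨fun x => if x ∈ ⋃₀ 𝓢 then μ else r x, fun ν hν => ?_, fun ν hν => ?_⟩
    · rcases le_or_gt μ ν with h | h
      · exact (mk_le_mk_of_subset fun x hx => hx.1).trans (hμ.le.trans h)
      · refine (mk_le_mk_of_subset ?_).trans (hr1 ν hν)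
        rintro x ⟨hxW, hx⟩
        by_cases hxK : x ∈ ⋃₀ 𝓢
        · simp only [if_pos hxK] at hx
          exact absurd hx h.not_ge
        · simp only [if_neg hxK] at hx
          exact ⟨⟨hxW, hxK⟩, hx⟩
    · have hK : ResolvableOn ν {x | x ∈ ⋃₀ 𝓢 ∧ μ = ν} := by
        by_cases h : μ = ν
        · simp only [h, and_true]
          exact resolvableOn_sUnion 𝓢 h2 fun S hS => h ▸ (h1 S hS).2.2
        · simp only [h, and_false]
          exact resolvableOn_empty ν
      convert hK.union (hr2 ν hν) fun x hx hx' => hx'.1.2 hx.1 using 1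
      ext x
      by_cases hxK : x ∈ ⋃₀ 𝓢
      · simp only [Set.mem_ofPred_eq, Set.mem_union, Set.mem_sdiff, hxK, hKW hxK]
        tauto
      · simp only [Set.mem_ofPred_eq, Set.mem_union, Set.mem_sdiff, hxK]
        tauto
  · set c := μ.ord.cof with hc
    have hcμ : c < μ := hsing.cof_ord_lt
    have hc0 : ℵ₀ ≤ c := Ordinal.aleph0_le_cof_iff.2 <| Ordinal.one_lt_cof_iff.2 (isSuccLimit_ord hμ0.le)
    have hι : #c.ord.ToType = c := mk_ord_toType c
    subst hμ
    obtain ⟨p, hp⟩ := exists_small_pieces W hsing c.ord.ToType hι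
    choose r hr using fun i => ih _ (hp i) {x | x ∈ W ∧ p x = i}
      (fun x hx => hWY hx.1) rfl
    have hbound : ∀ ν, c ≤ ν → #{x | x ∈ W ∧ r (p x) x ≤ ν} ≤ ν := by
      intro ν hν
      have h1 : {x | x ∈ W ∧ r (p x) x ≤ ν} ⊆
          ⋃ i, {x | x ∈ {x | x ∈ W ∧ p x = i} ∧ r i x ≤ ν} := by
        rintro x ⟨hxW, hx⟩
        exact Set.mem_iUnion.2 ⟨p x, ⟨hxW, rfl⟩, hx⟩
      refine (mk_le_mk_of_subset h1).trans ((mk_iUnion_le _).trans ?_)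
      rw [hι]
      exact (mul_le_mul' hν (ciSup_le' fun i => (hr i).1 ν (hc0.trans hν))).trans_eq
        (mul_eq_self (hc0.trans hν))
    obtain ⟨s, hs1, hs2⟩ := ih _ ((hbound c le_rfl).trans_lt hcμ) {x | x ∈ W ∧ r (p x) x ≤ c}
      (fun x hx => hWY hx.1) rfl
    refine ⟨fun x => if r (p x) x ≤ c then s x else r (p x) x, fun ν hν => ?_, fun ν hν => ?_⟩
    · rcases lt_or_ge ν c with h | h
      · refine (mk_le_mk_of_subset ?_).trans (hs1 ν hν)
        rintro x ⟨hxW, hx⟩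
        by_cases hxc : r (p x) x ≤ c
        · simp only [if_pos hxc] at hx
          exact ⟨⟨hxW, hxc⟩, hx⟩
        · simp only [if_neg hxc] at hx
          exact absurd (hx.trans h.le) hxc
      · refine (mk_le_mk_of_subset ?_).trans (hbound ν h)
        rintro x ⟨hxW, hx⟩
        by_cases hxc : r (p x) x ≤ c
        · exact ⟨hxW, hxc.trans h⟩
        · simp only [if_neg hxc] at hx
          exact ⟨hxW, hx⟩
    · have hK : ResolvableOn ν (⋃ i, {x | (x ∈ W ∧ p x = i) ∧ r i x = ν ∧ c < ν}) := by
        refine resolvableOn_iUnion _ (fun i j x hi hj => hi.1.2.symm.trans hj.1.2) fun i => ?_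
        by_cases h : c < ν
        · simp only [h, and_true]
          exact (hr i).2 ν hν
        · simp only [h, and_false]
          exact resolvableOn_empty ν
      convert (hs2 ν hν).union hK ?_ using 1
      · ext x
        simp only [Set.mem_ofPred_eq, Set.mem_union, Set.mem_iUnion]
        by_cases hxc : r (p x) x ≤ c
        · simp only [if_pos hxc]
          constructor
          · exact fun h => Or.inl ⟨⟨h.1, hxc⟩, h.2⟩
          · rintro (h | ⟨i, ⟨-, rfl⟩, h, h'⟩)
            · exact ⟨h.1.1, h.2⟩
            · exact absurd h' (h ▸ hxc).not_gt
        · simp only [if_neg hxc]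
          constructor
          · exact fun h => Or.inr ⟨p x, ⟨h.1, rfl⟩, h.2, h.2 ▸ not_le.1 hxc⟩
          · rintro (h | ⟨i, ⟨h, rfl⟩, h', -⟩)
            · exact absurd h.1.2 hxc
            · exact ⟨h, h'⟩
      · rintro x ⟨⟨-, hx⟩, -⟩ hx'
        obtain ⟨i, ⟨-, rfl⟩, h, h'⟩ := Set.mem_iUnion.1 hx'
        exact absurd h' (h ▸ hx).not_gt

theorem IsRanking.resolvableOn {κ : Cardinal.{u}} (hκ : ℵ₀ < κ) {Y : Set X}
    {r : X → Cardinal.{u}} (hr : IsRanking Y r) (hY : LocallyLarge κ Y) : ResolvableOn κ Y := by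
  classical
  choose! f hf using hr.2
  refine ⟨fun x => f (r x) x, fun k hk x hx => mem_closure_iff.2 fun U hU hxU => ?_⟩
  set ν := max ℵ₀ k.card with hν
  have hνκ : ν < κ := max_lt hκ (lt_ord.1 hk)
  obtain ⟨y, hyU, hyY, hy⟩ := hY.inter_diff_nonempty hκ.le
    ((hr.1 ν (le_max_left _ _)).trans_lt hνκ) hU ⟨x, hxU, hx⟩
  have hlt : ν < r y := by
    by_contra! h
    exact hy ⟨hyY, h⟩
  obtain ⟨w, hwU, ⟨hwY, hwr⟩, hw⟩ := mem_closure_iff.1 (hf (r y) ((le_max_left _ _).trans_lt hlt) k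
    (lt_ord.2 ((le_max_right _ _).trans_lt hlt)) ⟨hyY, rfl⟩) U hU hyU
  exact ⟨w, hwU, hwY, by simpa only [hwr] using hw⟩

theorem exists_resolvableOn_of_local_density_ge
    (hs : ∀ D : Set X, DiscreteTopology D → D.Countable)
    {κ : Cardinal.{u}} (hκ : ℵ₀ < κ) {Y : Set X} (hne : Y.Nonempty)
    (hY : ∀ U, IsOpen U → (U ∩ Y).Nonempty → ∀ M ⊆ U ∩ Y, #M < κ → ¬ U ∩ Y ⊆ closure M) :
    ∃ S ⊆ Y, S.Nonempty ∧ ResolvableOn κ S := by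
  obtain ⟨_, _⟩ := exists_wellFoundedLT X
  set L : Set X := {y | y ∈ Y ∧ y ∉ closure {w | w ∈ Y ∧ w < y}} with hL
  have key : ∀ U, IsOpen U → (U ∩ Y).Nonempty → κ ≤ #↑(U ∩ L) := by
    intro U hU hUY
    by_contra! hlt
    obtain ⟨x₀, hx₀, hx₀'⟩ := Set.not_subset.1
      (hY U hU hUY (U ∩ L) (fun x hx => ⟨hx.1, hx.2.1⟩) hlt)
    obtain ⟨x, ⟨⟨hxU, hxY⟩, hx⟩, hmin⟩ := exists_minimal_of_wellFoundedLT
      (fun x => x ∈ U ∩ Y ∧ x ∉ closure (U ∩ L)) ⟨x₀, hx₀, hx₀'⟩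
    have hxL : x ∈ closure {w | w ∈ Y ∧ w < x} := by
      by_contra h
      exact hx (subset_closure ⟨hxU, hxY, h⟩)
    obtain ⟨w, ⟨hwU, hw⟩, hwY, hwx⟩ := mem_closure_iff.1 hxL (U ∩ (closure (U ∩ L))ᶜ)
      (hU.inter isClosed_closure.isOpen_compl) ⟨hxU, hx⟩
    exact (hmin ⟨⟨hwU, hwY⟩, hw⟩ hwx.le).not_gt hwx
  have hLY : L ⊆ Y := fun x hx => hx.1
  have hstar : ∀ ν : Cardinal.{u}, ν.IsRegular → ℵ₀ < ν → ∀ W ⊆ L, ν ≤ #W →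
      ∃ S ⊆ W, S.Nonempty ∧ ResolvableOn ν S := by
    intro ν hν hν0 W hW hνW
    obtain ⟨z, hz⟩ := exists_seq (β := X) (c := ν) (fun x => x ∈ W)
      (fun _ A x => x ∉ A ∧ ∀ y ∈ W, y ∉ A → x ≤ y) (by
        intro _ A hA _
        obtain ⟨x₀, hx₀, hx₀'⟩ := sdiff_nonempty_of_mk_lt_mk (hA.trans_le hνW)
        obtain ⟨x, hx, hmin⟩ := exists_minimal_of_wellFoundedLT
          (fun x => x ∈ W ∧ x ∉ A) ⟨x₀, hx₀, hx₀'⟩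
        refine ⟨x, hx.1, hx.2, fun y hy hyA => ?_⟩
        by_contra! hlt
        exact (hmin ⟨hy, hyA⟩ hlt.le).not_gt hlt)
    have hlt : ∀ a b, b < a → z b < z a := by
      intro a b hab
      refine lt_of_le_of_ne ((hz b).2.2 _ (hz a).1 ?_) fun h => (hz a).2.1 ⟨b, hab, h⟩
      rintro ⟨c, hc, hca⟩
      exact (hz a).2.1 ⟨c, lt_trans hc hab, hca⟩
    obtain ⟨S, hS, hSne, hres⟩ := exists_resolvableOn_of_leftSeparated hs hν hν0 z fun a ha =>
      (hW (hz a).1).2 (closure_mono (by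
        rintro _ ⟨b, hb, rfl⟩
        exact ⟨hLY (hW (hz b).1), hlt a b hb⟩) ha)
    refine ⟨S, hS.trans ?_, hSne, hres⟩
    rintro _ ⟨a, rfl⟩
    exact (hz a).1
  obtain ⟨r, hr⟩ := exists_isRanking L hstar L subset_rfl
  refine ⟨L, hLY, ?_, hr.resolvableOn hκ fun U hU h =>
    key U hU (h.mono fun x hx => ⟨hx.1, hLY hx.2⟩)⟩
  have := key Set.univ isOpen_univ (by simpa using hne)
  rw [Set.univ_inter] at this
  rw [← Set.nonempty_coe_sort, ← mk_ne_zero_iff]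
  exact (aleph0_pos.trans (hκ.trans_le this)).ne'

theorem exists_small_dense
    (hs : ∀ D : Set X, DiscreteTopology D → D.Countable)
    {κ : Cardinal.{u}} (hκ : ℵ₀ ≤ κ) (hcof : ℵ₀ < κ.ord.cof) {Z : Set X}
    (hZ : ∀ Y ⊆ Z, Y.Nonempty → LocallyLarge κ Y → ∃ U, IsOpen U ∧ (U ∩ Y).Nonempty ∧
      ∃ M ⊆ U ∩ Y, #M < κ ∧ U ∩ Y ⊆ closure M)
    {Y : Set X} (hYZ : Y ⊆ Z) (hY : LocallyLarge κ Y) :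
    ∃ M ⊆ Y, #M < κ ∧ Y ⊆ closure M := by
  obtain ⟨𝓢, h1, h2, h3⟩ := exists_maximal_disjoint
    (fun S : Set X => ∃ U, IsOpen U ∧ S = U ∩ Y ∧ ∃ M ⊆ S, #M < κ ∧ S ⊆ closure M) Y
  choose U hU hSU M hMS hMκ hSM using fun S : 𝓢 => (h1 S S.2).2.2
  choose w hw using fun S : 𝓢 => (h1 S S.2).2.1
  have hcount : Countable 𝓢 := countable_of_discrete_points hs w U hU
    (fun S => ((hSU S).le (hw S)).1) fun S T h =>
      Subtype.ext (h2 S S.2 T T.2 (w T) ((hSU S).ge ⟨h, (h1 T T.2).1 (hw T)⟩) (hw T))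
  refine ⟨⋃₀ Set.range M, ?_, ?_, ?_⟩
  · rintro x ⟨_, ⟨S, rfl⟩, hx⟩
    exact (h1 S S.2).1 (hMS S hx)
  · refine mk_sUnion_lt_of_lt_cof hκ _ (mk_range_le.trans_lt ((mk_le_aleph0_iff.2 hcount).trans_lt
      hcof)) ?_
    rintro _ ⟨S, rfl⟩
    exact hMκ S
  · intro x hx
    by_contra hxM
    set V := (closure (⋃₀ Set.range M))ᶜ with hV
    have hVo : IsOpen V := isClosed_closure.isOpen_compl
    obtain ⟨U', hU', hne, M', hM', hM'κ, hUM'⟩ := hZ (V ∩ Y) (Set.inter_subset_right.trans hYZ)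
      ⟨x, hxM, hx⟩ (hY.inter hVo)
    obtain ⟨y, hy, T, hT, hyT⟩ := h3 (U' ∩ (V ∩ Y)) (fun y hy => hy.2.2) hne
      ⟨U' ∩ V, hU'.inter hVo, (Set.inter_assoc _ _ _).symm, M', hM', hM'κ, hUM'⟩
    exact hy.2.1 (closure_mono (Set.subset_sUnion_of_mem (Set.mem_range_self _)) (hSM ⟨T, hT⟩ hyT))

theorem exists_small_dense_resolvableOn
    (hs : ∀ D : Set X, DiscreteTopology D → D.Countable)
    {κ ν : Cardinal.{u}} (hκ : ℵ₀ ≤ κ) {Z : Set X} (hν : ν.IsRegular) (hν0 : ℵ₀ < ν) (hνκ : ν < κ)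
    (hdense : ∀ Y ⊆ Z, LocallyLarge κ Y → ∃ M ⊆ Y, #M < κ ∧ Y ⊆ closure M)
    (hres : ∀ S ⊆ Z, S.Nonempty → ¬ ResolvableOn κ S)
    {Y : Set X} (hYZ : Y ⊆ Z) (hY : LocallyLarge κ Y) :
    ∃ D ⊆ Y, #D < κ ∧ Y ⊆ closure D ∧ ResolvableOn ν D := by
  obtain ⟨𝓢, h1, h2, h3⟩ := exists_maximal_disjoint
    (fun S : Set X => #S ≤ ν ∧ ResolvableOn ν S) Y
  have hSY : ⋃₀ 𝓢 ⊆ Y := Set.sUnion_subset fun S hS => (h1 S hS).1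
  have key : ∀ U, IsOpen U → (U ∩ Y).Nonempty → κ ≤ #↑(U ∩ ⋃₀ 𝓢) := by
    intro U hU hne
    by_contra! hlt
    have heq : ∀ V : Set X, V ∩ (U ∩ (Y \ ⋃₀ 𝓢)) = V ∩ U ∩ (Y \ (U ∩ ⋃₀ 𝓢)) := by
      intro V; ext x
      simp only [Set.mem_inter_iff, Set.mem_sdiff]
      tauto
    have hlarge : LocallyLarge κ (U ∩ (Y \ ⋃₀ 𝓢)) := by
      intro V hV hVne
      rw [heq]
      exact hY.inter_diff hκ hlt (hV.inter hU) (hVne.mono fun x hx => ⟨⟨hx.1, hx.2.1⟩, hx.2.2.1⟩)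
    have hne' : (U ∩ (Y \ ⋃₀ 𝓢)).Nonempty := by
      have := hY.inter_diff_nonempty hκ hlt hU hne
      have h := heq Set.univ
      rw [Set.univ_inter, Set.univ_inter] at h
      rwa [h]
    refine hres _ (fun x hx => hYZ hx.2.1) hne' (resolvableOn_of_density_lt (ν := ν) hκ hlarge
      (exists_resolvableOn_or_density_lt hs hν hν0 _ fun S hS hSne hSν hSres => ?_)
      fun 𝒜 h𝒜 h => mk_sUnion_lt_of_lt hκ hνκ 𝒜 h𝒜 fun a ha => (h a ha).le)
    obtain ⟨x, hx, hx'⟩ := h3 S (fun x hx => (hS hx).2.1) hSne ⟨hSν, hSres⟩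
    exact (hS hx).2.2 hx'
  obtain ⟨M, hM, hMκ, hMd⟩ := hdense (⋃₀ 𝓢) (hSY.trans hYZ) fun U hU hne =>
    key U hU (hne.mono fun x hx => ⟨hx.1, hSY hx.2⟩)
  set 𝓣 : Set (Set X) := {S | S ∈ 𝓢 ∧ (S ∩ M).Nonempty} with h𝓣
  have hcl : Y ⊆ closure (⋃₀ 𝓢) := by
    intro x hx
    refine mem_closure_iff.2 fun U hU hxU => ?_
    have := key U hU ⟨x, hxU, hx⟩
    rw [← Set.nonempty_coe_sort, ← mk_ne_zero_iff]
    exact (aleph0_pos.trans_le (hκ.trans this)).ne'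
  refine ⟨⋃₀ 𝓣, (Set.sUnion_subset_sUnion fun S hS => hS.1).trans hSY, ?_, ?_, ?_⟩
  · refine mk_sUnion_lt_of_lt hκ hνκ 𝓣 (lt_of_le_of_lt ?_ hMκ) fun S hS => (h1 S hS.1).2.2.1
    choose w hw using fun S : 𝓣 => S.2.2
    exact ⟨⟨fun S => ⟨w S, (hw S).2⟩, fun S T h => Subtype.ext
      (h2 S S.2.1 T T.2.1 (w S) (hw S).1 (by
        have := Subtype.mk.inj h
        rw [this]; exact (hw T).1))⟩⟩
  · refine hcl.trans (closure_minimal (hMd.trans (closure_mono ?_)) isClosed_closure)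
    intro x hx
    obtain ⟨S, hS, hxS⟩ := hM hx
    exact ⟨S, ⟨hS, x, hxS, hx⟩, hxS⟩
  · exact resolvableOn_sUnion 𝓣 (fun S hS T hT => h2 S hS.1 T hT.1) fun S hS => (h1 S hS.1).2.2.2

theorem LocallyLarge.exists_resolvableOn
    (hs : ∀ D : Set X, DiscreteTopology D → D.Countable)
    {κ : Cardinal.{u}} (hκ : ℵ₀ < κ) {Z : Set X} (hne : Z.Nonempty) (hZ : LocallyLarge κ Z) :
    ∃ S ⊆ Z, S.Nonempty ∧ ResolvableOn κ S := by
  rcases isRegular_or_isSingular hκ.le with hreg | hsing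
  · exact ⟨Z, subset_rfl, hne, hZ.resolvableOn_of_isRegular hs hreg hκ⟩
  have hcof0 : ℵ₀ ≤ κ.ord.cof := Ordinal.aleph0_le_cof_iff.2 <| Ordinal.one_lt_cof_iff.2 (isSuccLimit_ord hκ.le)
  rcases hcof0.eq_or_lt with hcof | hcof
  · exact ⟨Z, subset_rfl, hne, hZ.resolvableOn_of_cof_eq_aleph0 hs hsing hcof.symm⟩
  by_contra! hres
  have hlocal : ∀ Y ⊆ Z, Y.Nonempty → LocallyLarge κ Y → ∃ U, IsOpen U ∧ (U ∩ Y).Nonempty ∧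
      ∃ M ⊆ U ∩ Y, #M < κ ∧ U ∩ Y ⊆ closure M := by
    intro Y hYZ hYne _
    by_contra! hcon
    obtain ⟨S, hS, hSne, h⟩ := exists_resolvableOn_of_local_density_ge hs hκ hYne hcon
    exact hres S (hS.trans hYZ) hSne h
  obtain ⟨l, hl, hlc⟩ := exists_cofinal_regular hsing κ.ord.cof.ord.ToType (mk_ord_toType _)
  obtain ⟨D, hD⟩ := exists_seq (β := Set X) (c := κ.ord.cof) (fun D => D ⊆ Z ∧ #D < κ)
    (fun i 𝒜 D => Z ⊆ closure D ∧ ResolvableOn (l i) D ∧ ∀ x ∈ D, x ∉ ⋃₀ 𝒜) (by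
      intro i 𝒜 h𝒜 hP
      have h1 : #↑(⋃₀ 𝒜) < κ := mk_sUnion_lt_of_lt_cof hκ.le 𝒜 h𝒜 fun a ha => (hP a ha).2
      obtain ⟨D, hD, hDκ, hDd, hDr⟩ := exists_small_dense_resolvableOn hs hκ.le (hl i).1 (hl i).2.1
        (hl i).2.2 (fun Y => exists_small_dense hs hκ.le hcof hlocal) hres
        (Set.sdiff_subset (s := Z) (t := ⋃₀ 𝒜)) (hZ.diff hκ.le h1)
      exact ⟨D, ⟨hD.trans Set.sdiff_subset, hDκ⟩, (hZ.subset_closure_diff hκ.le h1).trans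
        (closure_minimal hDd isClosed_closure), hDr, fun x hx => (hD hx).2⟩)
  have hlt : ∀ i j, i < j → ∀ x ∈ D i, x ∉ D j := fun i j hij x hi hj =>
    (hD j).2.2.2 x hj ⟨_, ⟨i, hij, rfl⟩, hi⟩
  refine hres Z subset_rfl hne (resolvableOn_of_cofinal D (fun i j x hi hj => ?_)
    (fun i => (hD i).1.1) l (fun i => (hD i).2.2.1) fun k hk => ?_)
  · by_contra hij
    rcases lt_or_gt_of_ne hij with h | h
    · exact hlt _ _ h x hi hj
    · exact hlt _ _ h x hj hi
  · obtain ⟨i, hi⟩ := hlc k hk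
    exact ⟨i, hi, (hD i).2.1⟩

theorem LocallyLarge.resolvableOn
    (hs : ∀ D : Set X, DiscreteTopology D → D.Countable)
    {κ : Cardinal.{u}} (hκ : ℵ₀ < κ) {Z : Set X} (hZ : LocallyLarge κ Z) : ResolvableOn κ Z :=
  resolvableOn_of_exhaustion fun _ hU hne => (hZ.inter hU).exists_resolvableOn hs hκ hne

theorem ResolvableOn.resolvable [Nonempty X] {c : Cardinal.{u}}
    (h : ResolvableOn c (Set.univ : Set X)) : Resolvable X c := by
  obtain ⟨f, hf⟩ := h
  have hd : ∀ t : c.ord.ToType, Dense {x | f x = Ordinal.ToType.mk.symm t} := fun t x => by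
    simpa using hf _ (Ordinal.ToType.mk.symm t).2 (Set.mem_univ x)
  have hinj : ∀ s t : c.ord.ToType, ∀ x, f x = Ordinal.ToType.mk.symm s →
      f x = Ordinal.ToType.mk.symm t → s = t := fun s t x hx hy =>
    Ordinal.ToType.mk.symm.injective (Subtype.ext (hx.symm.trans hy))
  refine ⟨Set.range fun t : c.ord.ToType => {x | f x = Ordinal.ToType.mk.symm t}, ?_, ?_, ?_⟩
  · rw [mk_range_eq, mk_ord_toType]
    intro s t hst
    obtain ⟨x, hx⟩ := (hd s).nonempty
    exact hinj s t x hx (hst.le hx)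
  · rintro _ ⟨t, rfl⟩
    exact hd t
  · rintro _ ⟨s, rfl⟩ _ ⟨t, rfl⟩ hst
    refine Set.disjoint_left.2 fun x hx hy => hst ?_
    rw [hinj s t x hx hy]

end Spread

/-- If X has countable spread (every discrete subspace is countable) and Δ(X) > ω,
then X is maximally resolvable. -/
theorem maximallyResolvable_of_countable_spread (X : Type*) [TopologicalSpace X]
    (hspread : ∀ D : Set X, DiscreteTopology D → D.Countable)
    (hdelta : Cardinal.aleph0 < Delta X) : MaximallyResolvable X := by
  have hlarge : LocallyLarge (Delta X) (Set.univ : Set X) := by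
    intro U hU hne
    rw [Set.inter_univ] at hne ⊢
    exact csInf_le' ⟨U, hU, hne, rfl⟩
  have hne : Nonempty X := by
    by_contra hX
    rw [not_nonempty_iff] at hX
    have : {c : Cardinal | ∃ U : Set X, IsOpen U ∧ U.Nonempty ∧ #U = c} = ∅ :=
      Set.eq_empty_of_forall_notMem fun c ⟨U, _, hU, _⟩ => hX.elim hU.some
    rw [Delta, this, Cardinal.sInf_empty] at hdelta
    exact hdelta.not_ge zero_le
  exact (hlarge.resolvableOn hspread hdelta).resolvable
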